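/- Let q be a formal variable, and for i ≠ j let a_{ij} ≤ 0 be integers with d_i a_{ij} = d_j a_{ji}. In the quantum shuffle algebra Sh(V) built on V = ⊕ᵢ C vᵢ with braiding vᵢ ⊗ vⱼ ↦ q^{−d_i a_{ij}} vⱼ ⊗ vᵢ, the elements [vᵢ] satisfy the quantum Serre relations: Σ_{k=0}^{1−a_{ij}} (−1)^k binom_q^{d_i}(1−a_{ij}, k) [vᵢ]^{*k} * [vⱼ] * [vᵢ]^{*(1−a_{ij}−k)} = 0, where * is the shuffle product and binom_q(m,p) is the q-binomial coefficient. -/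

import Mathlib

open scoped Classical

noncomputable section

/-- The base field `ℚ(q)`, with `q` a formal variable. -/
abbrev QField : Type := RatFunc ℚ

/-- The formal variable `q`. -/
def qvar : QField := RatFunc.X

/-- The quantum integer `[m]_z = (zᵐ - z⁻ᵐ)/(z - z⁻¹)`. -/
def qInt (z : QField) (m : ℤ) : QField := (z ^ m - z ^ (-m)) / (z - z⁻¹)

/-- The quantum factorial `[m]_z!`. -/
def qFact (z : QField) : ℕ → QField
  | 0 => 1
  | m + 1 => qInt z (m + 1) * qFact z m

/-- The quantum binomial coefficient `binom_z(m, p)`. -/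
def qBinom (z : QField) (m p : ℕ) : QField := qFact z m / (qFact z p * qFact z (m - p))

variable {n : ℕ}

/-- The shuffle product of two basis words `w₁`, `w₂` in the quantum shuffle algebra built
on `V = ⊕ᵢ ℂ vᵢ` with braiding `vᵢ ⊗ vⱼ ↦ q^{-dᵢ a_{ij}} vⱼ ⊗ vᵢ`:
`[z₁|⋯|z_k] * [z_{k+1}|⋯|z_{k+l}] = Σ_{σ ∈ Σ_{k,l}} q^{-Σ_{i<j, σ(i)>σ(j)} ⟨deg z_i, deg z_j⟩}
[z_{σ⁻¹(1)}|⋯|z_{σ⁻¹(k+l)}]`. -/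
def shWord (d : Fin n → ℤ) (a : Fin n → Fin n → ℤ) (w₁ w₂ : List (Fin n)) :
    List (Fin n) →₀ QField :=
  ∑ σ ∈ Finset.univ.filter
      (fun σ : Equiv.Perm (Fin (w₁ ++ w₂).length) =>
        ∀ p q : Fin (w₁ ++ w₂).length, p < q →
          (((p : ℕ) < w₁.length ∧ (q : ℕ) < w₁.length) ∨
            (w₁.length ≤ (p : ℕ) ∧ w₁.length ≤ (q : ℕ))) → σ p < σ q),
    (qvar ^ (-(∑ pq ∈ Finset.univ.filter
        (fun pq : Fin (w₁ ++ w₂).length × Fin (w₁ ++ w₂).length =>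
          pq.1 < pq.2 ∧ σ pq.2 < σ pq.1),
        d ((w₁ ++ w₂).get pq.1) * a ((w₁ ++ w₂).get pq.1) ((w₁ ++ w₂).get pq.2)))) •
      Finsupp.single (List.ofFn (fun m => (w₁ ++ w₂).get (σ.symm m))) (1 : QField)

/-- The quantum shuffle product, extended bilinearly. -/
def shMul (d : Fin n → ℤ) (a : Fin n → Fin n → ℤ) (f g : List (Fin n) →₀ QField) :
    List (Fin n) →₀ QField :=
  f.sum fun w₁ c₁ => g.sum fun w₂ c₂ => (c₁ * c₂) • shWord d a w₁ w₂

/-- Shuffle powers `x^{*k}`. -/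
def shPow (d : Fin n → ℤ) (a : Fin n → Fin n → ℤ) (x : List (Fin n) →₀ QField) :
    ℕ → List (Fin n) →₀ QField
  | 0 => Finsupp.single [] 1
  | m + 1 => shMul d a x (shPow d a x m)


/-! ### Shuffles indexed by block functions -/

/-- Sum over all permutations increasing on blocks. -/
def blockSum (B : Fin n → Fin n → ℤ) (N : ℕ) (f : Fin N → Fin n) (b : Fin N → Prop) :
    List (Fin n) →₀ QField :=
  ∑ σ : Equiv.Perm (Fin N), if (∀ r s, r < s → (b r ↔ b s) → σ r < σ s) then
    (qvar ^ (-(∑ r, ∑ s, if r < s ∧ σ s < σ r then B (f r) (f s) else 0))) •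
      Finsupp.single (List.ofFn (fun m => f (σ.symm m))) (1 : QField) else 0

theorem shWord_eq_blockSum (d : Fin n → ℤ) (a : Fin n → Fin n → ℤ) (w₁ w₂ : List (Fin n)) :
    shWord d a w₁ w₂ = blockSum (fun x y => d x * a x y) (w₁ ++ w₂).length (w₁ ++ w₂).get
      (fun p => (p : ℕ) < w₁.length) := by
  unfold shWord blockSum
  rw [Finset.sum_filter]
  refine Finset.sum_congr rfl fun σ _ => ?_
  have hiff : (∀ p q : Fin (w₁ ++ w₂).length, p < q →
          (((p : ℕ) < w₁.length ∧ (q : ℕ) < w₁.length) ∨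
            (w₁.length ≤ (p : ℕ) ∧ w₁.length ≤ (q : ℕ))) → σ p < σ q) ↔
      (∀ r s : Fin (w₁ ++ w₂).length, r < s →
        ((fun p : Fin (w₁ ++ w₂).length => (p : ℕ) < w₁.length) r ↔
          (fun p : Fin (w₁ ++ w₂).length => (p : ℕ) < w₁.length) s) → σ r < σ s) := by
    refine forall_congr' fun r => forall_congr' fun s => forall_congr' fun h => ?_
    refine imp_congr_left ?_
    simp only
    constructor <;> intro h <;> omega
  by_cases h : ∀ p q : Fin (w₁ ++ w₂).length, p < q →
          (((p : ℕ) < w₁.length ∧ (q : ℕ) < w₁.length) ∨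
            (w₁.length ≤ (p : ℕ) ∧ w₁.length ≤ (q : ℕ))) → σ p < σ q
  · rw [if_pos h, if_pos (hiff.1 h), Finset.sum_filter, ← Finset.univ_product_univ,
      Finset.sum_product]
  · rw [if_neg h, if_neg (fun h' => h (hiff.2 h'))]

/-- Insert position `p` as the preimage of `0`. -/
def insPerm {N : ℕ} (p : Fin (N + 1)) (τ : Equiv.Perm (Fin N)) : Equiv.Perm (Fin (N + 1)) :=
  (finSuccEquiv' p).trans ((Equiv.optionCongr τ).trans (finSuccEquiv' 0).symm)

theorem insPerm_self {N : ℕ} (p : Fin (N + 1)) (τ : Equiv.Perm (Fin N)) :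
    insPerm p τ p = 0 := by simp [insPerm]

theorem insPerm_succAbove {N : ℕ} (p : Fin (N + 1)) (τ : Equiv.Perm (Fin N)) (r : Fin N) :
    insPerm p τ (p.succAbove r) = (τ r).succ := by simp [insPerm]

theorem insPerm_symm_zero {N : ℕ} (p : Fin (N + 1)) (τ : Equiv.Perm (Fin N)) :
    (insPerm p τ).symm 0 = p := by rw [Equiv.symm_apply_eq, insPerm_self]

theorem insPerm_symm_succ {N : ℕ} (p : Fin (N + 1)) (τ : Equiv.Perm (Fin N)) (r : Fin N) :
    (insPerm p τ).symm r.succ = p.succAbove (τ.symm r) := by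
  rw [Equiv.symm_apply_eq, insPerm_succAbove]; simp

theorem insPerm_bijective (N : ℕ) :
    Function.Bijective (fun x : Fin (N + 1) × Equiv.Perm (Fin N) => insPerm x.1 x.2) := by
  rw [Fintype.bijective_iff_injective_and_card]
  constructor
  · rintro ⟨p, τ⟩ ⟨p', τ'⟩ h
    simp only at h
    have hp : p = p' := by
      rw [← insPerm_symm_zero p τ, h, insPerm_symm_zero]
    subst hp
    congr 1
    ext r
    have := congrArg (fun e => e (p.succAbove r)) h
    simp only [insPerm_succAbove] at this
    rw [Fin.succ_injective _ this]
  · simp [Fintype.card_perm, Nat.factorial_succ]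

theorem insPerm_good {N : ℕ} (b : Fin (N + 1) → Prop) (p : Fin (N + 1))
    (τ : Equiv.Perm (Fin N)) :
    (∀ r s, r < s → (b r ↔ b s) → insPerm p τ r < insPerm p τ s) ↔
      ((∀ r, r < p → ¬ (b r ↔ b p)) ∧
        ∀ r s, r < s → (b (p.succAbove r) ↔ b (p.succAbove s)) → τ r < τ s) := by
  constructor
  · intro h
    refine ⟨fun r hr hb => ?_, fun r s hrs hb => ?_⟩
    · have := h r p hr hb
      rw [insPerm_self] at this
      exact absurd this (Fin.not_lt_zero _)
    · have := h _ _ ((Fin.succAbove_lt_succAbove_iff (p := p)).2 hrs) hb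
      simpa [insPerm_succAbove] using this
  · rintro ⟨h1, h2⟩ r s hrs hb
    rcases Fin.eq_self_or_eq_succAbove p s with rfl | ⟨s, rfl⟩
    · exact absurd hb (h1 r hrs)
    rcases Fin.eq_self_or_eq_succAbove p r with rfl | ⟨r, rfl⟩
    · rw [insPerm_self, insPerm_succAbove]; exact Fin.succ_pos _
    · rw [insPerm_succAbove, insPerm_succAbove, Fin.succ_lt_succ_iff]
      exact h2 r s ((Fin.succAbove_lt_succAbove_iff (p := p)).1 hrs) hb

theorem insPerm_inv {N : ℕ} (F : Fin (N + 1) → Fin (N + 1) → ℤ) (p : Fin (N + 1))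
    (τ : Equiv.Perm (Fin N)) :
    (∑ r, ∑ s, if r < s ∧ insPerm p τ s < insPerm p τ r then F r s else 0) =
      (∑ r, if r < p then F r p else 0) +
      ∑ r, ∑ s, if r < s ∧ τ s < τ r then F (p.succAbove r) (p.succAbove s) else 0 := by
  rw [Fin.sum_univ_succAbove _ p, Fin.sum_univ_succAbove (fun r => if r < p then F r p else 0) p]
  simp only [fun r => Fin.sum_univ_succAbove (fun s => if p.succAbove r < s ∧
    insPerm p τ s < insPerm p τ (p.succAbove r) then F (p.succAbove r) s else 0) p]
  simp [insPerm_self, insPerm_succAbove, Finset.sum_add_distrib]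

/-- Prepending a letter. -/
def consL (x : Fin n) : (List (Fin n) →₀ QField) →ₗ[QField] (List (Fin n) →₀ QField) :=
  Finsupp.linearCombination QField (fun w => Finsupp.single (x :: w) 1)

theorem consL_single (x : Fin n) (w : List (Fin n)) :
    consL x (Finsupp.single w 1) = Finsupp.single (x :: w) 1 := by
  simp [consL]

theorem qvar_ne_zero : qvar ≠ 0 := RatFunc.X_ne_zero

theorem blockSum_succ (B : Fin n → Fin n → ℤ) (N : ℕ) (f : Fin (N + 1) → Fin n)
    (b : Fin (N + 1) → Prop) :
    blockSum B (N + 1) f b = ∑ p : Fin (N + 1), if (∀ r, r < p → ¬ (b r ↔ b p)) then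
      (qvar ^ (-(∑ r, if r < p then B (f r) (f p) else 0))) •
        consL (f p) (blockSum B N (fun r => f (p.succAbove r)) (fun r => b (p.succAbove r)))
      else 0 := by
  unfold blockSum
  rw [← (insPerm_bijective N).sum_comp, Fintype.sum_prod_type]
  refine Finset.sum_congr rfl fun p _ => ?_
  by_cases hp : ∀ r, r < p → ¬ (b r ↔ b p)
  · rw [if_pos hp, map_sum, Finset.smul_sum]
    refine Finset.sum_congr rfl fun τ _ => ?_
    simp only [insPerm_good]
    by_cases hτ : ∀ r s, r < s → (b (p.succAbove r) ↔ b (p.succAbove s)) → τ r < τ s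
    · rw [if_pos ⟨hp, hτ⟩, if_pos hτ, map_smul, consL_single, smul_smul,
        ← zpow_add₀ qvar_ne_zero, insPerm_inv (fun r s => B (f r) (f s)), List.ofFn_succ, neg_add]
      simp only [insPerm_symm_zero, insPerm_symm_succ]
    · rw [if_neg (fun h => hτ h.2), if_neg hτ, map_zero, smul_zero]
  · rw [if_neg hp]
    refine Finset.sum_eq_zero fun τ _ => ?_
    simp only [insPerm_good]
    rw [if_neg (fun h => hp h.1)]

theorem blockSum_congr (B : Fin n → Fin n → ℤ) {N M : ℕ} (h : N = M) (f : Fin N → Fin n)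
    (b : Fin N → Prop) (f' : Fin M → Fin n) (b' : Fin M → Prop)
    (hf : ∀ r, f r = f' (Fin.cast h r)) (hb : ∀ r, b r ↔ b' (Fin.cast h r)) :
    blockSum B N f b = blockSum B M f' b' := by
  subst h
  have h1 : f = f' := funext hf
  have h2 : b = b' := funext fun r => propext (hb r)
  rw [h1, h2]

/-! ### Recursion for the shuffle product of words -/

theorem shWord_nil_nil (d : Fin n → ℤ) (a : Fin n → Fin n → ℤ) :
    shWord d a [] [] = Finsupp.single [] 1 := by
  rw [shWord_eq_blockSum]
  simp [blockSum]

theorem shWord_nil_cons (d : Fin n → ℤ) (a : Fin n → Fin n → ℤ) (y : Fin n) (v : List (Fin n)) :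
    shWord d a [] (y :: v) = consL y (shWord d a [] v) := by
  rw [shWord_eq_blockSum, shWord_eq_blockSum]
  refine (blockSum_succ _ v.length _ _).trans ?_
  rw [Finset.sum_eq_single 0]
  · rw [if_pos (by intro r hr; exact absurd hr (Fin.not_lt_zero _))]
    simp
    rfl
  · intro p _ hp
    rw [if_neg]
    intro h
    exact h 0 (Fin.pos_of_ne_zero hp) (by simp)
  · simp

theorem shWord_cons_nil (d : Fin n → ℤ) (a : Fin n → Fin n → ℤ) (x : Fin n) (u : List (Fin n)) :
    shWord d a (x :: u) [] = consL x (shWord d a u []) := by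
  rw [shWord_eq_blockSum, shWord_eq_blockSum]
  refine (blockSum_succ _ (u ++ []).length _ _).trans ?_
  rw [Finset.sum_eq_single 0]
  · rw [if_pos (by intro r hr; exact absurd hr (Fin.not_lt_zero _))]
    simp
    congr 1
    refine blockSum_congr _ rfl _ _ _ _ ?_ ?_ <;> simp
  · intro p _ hp
    rw [if_neg]
    intro h
    have := p.2
    refine h 0 (Fin.pos_of_ne_zero hp) ?_
    simp at this ⊢
    omega
  · simp

/-- The pairing of the degree of a word with a letter. -/
def wt (d : Fin n → ℤ) (a : Fin n → Fin n → ℤ) (w : List (Fin n)) (y : Fin n) : ℤ :=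
  (w.map fun x => d x * a x y).sum

theorem sum_lt_getElem (w v : List (Fin n)) (g : Fin n → ℤ) :
    (∑ r : Fin (w ++ v).length, if (r : ℕ) < w.length then g ((w ++ v).get r) else 0) =
      (w.map g).sum := by
  induction w with
  | nil => simp
  | cons x u ih =>
    refine (Fin.sum_univ_succ (n := (u ++ v).length) _).trans ?_
    rw [List.map_cons, List.sum_cons, ← ih]
    simp

theorem shWord_cons_cons (d : Fin n → ℤ) (a : Fin n → Fin n → ℤ) (x y : Fin n)
    (u v : List (Fin n)) :
    shWord d a (x :: u) (y :: v) = consL x (shWord d a u (y :: v)) +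
      qvar ^ (-wt d a (x :: u) y) • consL y (shWord d a (x :: u) v) := by
  rw [shWord_eq_blockSum, shWord_eq_blockSum, shWord_eq_blockSum]
  refine (blockSum_succ _ (u ++ y :: v).length _ _).trans ?_
  let p : Fin ((u ++ y :: v).length + 1) := ⟨u.length + 1, by simp⟩
  have hp0 : (0 : Fin ((u ++ y :: v).length + 1)) ≠ p := by
    intro h; have := congrArg Fin.val h; simp [p] at this
  rw [Finset.sum_eq_add 0 p hp0]
  · congr 1
    · rw [if_pos (by intro r hr; exact absurd hr (Fin.not_lt_zero _))]
      simp
      rfl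
    · rw [if_pos]
      · have hy : (x :: u ++ y :: v).get p = y := by
          simp [p]
        congr 1
        · congr 2
          rw [wt, ← sum_lt_getElem (x :: u) (y :: v)]
          refine Finset.sum_congr rfl fun r _ => ?_
          refine if_congr ?_ ?_ rfl
          · simp [p, Fin.lt_def]
          · exact congrArg (fun t => d ((x :: u ++ y :: v).get r) * a ((x :: u ++ y :: v).get r) t) hy
        · have hy' := hy
          rw [hy]
          congr 1
          refine blockSum_congr _ (by simp; omega) _ _ _ _ ?_ ?_
          · intro r
            have hr := r.2
            simp only [List.get_eq_getElem, Fin.val_cast]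
            by_cases h : (r : ℕ) < u.length + 1
            · have : ((p.succAbove r : Fin _) : ℕ) = r := by
                rw [Fin.succAbove_of_castSucc_lt]
                · rfl
                · simpa [p, Fin.lt_def] using h
              simp only [this]
              rw [List.getElem_append_left (by simpa using h), List.getElem_append_left (by simpa using h)]
            · have : ((p.succAbove r : Fin _) : ℕ) = r + 1 := by
                rw [Fin.succAbove_of_le_castSucc]
                · rfl
                · simp [p, Fin.le_def]; omega
              simp only [this]
              rw [List.getElem_append_right (by simp; omega), List.getElem_append_right (by simp; omega)]
              rw [List.getElem_cons]
              rw [dif_neg (by simp; omega)]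
              congr 1
              simp
              omega
          · intro r
            simp only [Fin.val_cast, List.length_cons]
            by_cases h : (r : ℕ) < u.length + 1
            · have : ((p.succAbove r : Fin _) : ℕ) = r := by
                rw [Fin.succAbove_of_castSucc_lt]
                · rfl
                · simpa [p, Fin.lt_def] using h
              rw [this]
            · have : ((p.succAbove r : Fin _) : ℕ) = r + 1 := by
                rw [Fin.succAbove_of_le_castSucc]
                · rfl
                · simp [p, Fin.le_def]; omega
              rw [this]
              omega
      · intro r hr
        have : (r : ℕ) < u.length + 1 := hr
        simp [p]
        omega
  · intro r _ hr
    rw [if_neg]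
    intro h
    by_cases hlt : (r : ℕ) < u.length + 1
    · refine h 0 (Fin.pos_of_ne_zero hr.1) ?_
      simp
      omega
    · have hne : (r : ℕ) ≠ u.length + 1 := fun h => hr.2 (Fin.ext h)
      refine h p (by simp [p, Fin.lt_def]; omega) ?_
      simp [p]
      omega
  · simp
  · simp

/-! ### Bilinear product, derivations and twists -/

/-- The shuffle product as a bilinear map. -/
def shL (d : Fin n → ℤ) (a : Fin n → Fin n → ℤ) : (List (Fin n) →₀ QField) →ₗ[QField]
    (List (Fin n) →₀ QField) →ₗ[QField] (List (Fin n) →₀ QField) :=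
  Finsupp.linearCombination QField
    (fun w₁ => Finsupp.linearCombination QField (fun w₂ => shWord d a w₁ w₂))

theorem shMul_eq (d : Fin n → ℤ) (a : Fin n → Fin n → ℤ) (f g : List (Fin n) →₀ QField) :
    shMul d a f g = shL d a f g := by
  unfold shMul shL
  rw [Finsupp.linearCombination_apply, Finsupp.sum, Finsupp.sum, LinearMap.sum_apply]
  refine Finset.sum_congr rfl fun w _ => ?_
  rw [LinearMap.smul_apply, Finsupp.linearCombination_apply, Finsupp.sum, Finsupp.sum,
    Finset.smul_sum]
  simp only [smul_smul]

theorem shL_single (d : Fin n → ℤ) (a : Fin n → Fin n → ℤ) (u v : List (Fin n)) :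
    shL d a (Finsupp.single u 1) (Finsupp.single v 1) = shWord d a u v := by
  simp [shL]

/-- Removing the first letter `y`. -/
def dL (y : Fin n) : (List (Fin n) →₀ QField) →ₗ[QField] (List (Fin n) →₀ QField) :=
  Finsupp.lcomapDomain (List.cons y) (List.cons_injective)

theorem dL_apply (y : Fin n) (f : List (Fin n) →₀ QField) (w : List (Fin n)) :
    dL y f w = f (y :: w) := rfl

theorem ext_dL (f : List (Fin n) →₀ QField) (h0 : f [] = 0) (h : ∀ y, dL y f = 0) : f = 0 := by
  ext w
  cases w with
  | nil => exact h0
  | cons y w => rw [← dL_apply, h]; rfl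

theorem dL_single_nil (y : Fin n) : dL y (Finsupp.single [] 1) = 0 := by
  ext w
  rw [dL_apply]
  simp

theorem dL_single_cons (y x : Fin n) (w : List (Fin n)) :
    dL y (Finsupp.single (x :: w) 1) = if x = y then Finsupp.single w 1 else 0 := by
  ext v
  rw [dL_apply]
  by_cases h : x = y
  · subst h
    simp [Finsupp.single_apply]
  · simp [h]

theorem linMap_ext {M : Type*} [AddCommMonoid M] [Module QField M]
    (F G : (List (Fin n) →₀ QField) →ₗ[QField] M)
    (h : ∀ w, F (Finsupp.single w 1) = G (Finsupp.single w 1)) : F = G := by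
  apply Finsupp.lhom_ext'
  intro w
  ext
  simpa using h w

theorem dL_consL (y x : Fin n) (f : List (Fin n) →₀ QField) :
    dL y (consL x f) = if x = y then f else 0 := by
  have : (dL y).comp (consL x) = if x = y then LinearMap.id else 0 := by
    apply linMap_ext
    intro w
    rw [LinearMap.comp_apply, consL_single, dL_single_cons]
    split_ifs <;> rfl
  rw [← LinearMap.comp_apply, this]
  split_ifs <;> rfl

/-- The twist. -/
def kL (d : Fin n → ℤ) (a : Fin n → Fin n → ℤ) (y : Fin n) :
    (List (Fin n) →₀ QField) →ₗ[QField] (List (Fin n) →₀ QField) :=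
  Finsupp.linearCombination QField (fun w => qvar ^ (-wt d a w y) • Finsupp.single w 1)

theorem kL_single (d : Fin n → ℤ) (a : Fin n → Fin n → ℤ) (y : Fin n) (w : List (Fin n)) :
    kL d a y (Finsupp.single w 1) = qvar ^ (-wt d a w y) • Finsupp.single w 1 := by
  rw [kL, Finsupp.linearCombination_single, one_smul]

theorem shWord_nil_left (d : Fin n → ℤ) (a : Fin n → Fin n → ℤ) (v : List (Fin n)) :
    shWord d a [] v = Finsupp.single v 1 := by
  induction v with
  | nil => exact shWord_nil_nil d a
  | cons y v ih => rw [shWord_nil_cons, ih, consL_single]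

theorem shWord_nil_right (d : Fin n → ℤ) (a : Fin n → Fin n → ℤ) (v : List (Fin n)) :
    shWord d a v [] = Finsupp.single v 1 := by
  induction v with
  | nil => exact shWord_nil_nil d a
  | cons y v ih => rw [shWord_cons_nil, ih, consL_single]

theorem shL_one_left (d : Fin n → ℤ) (a : Fin n → Fin n → ℤ) (f : List (Fin n) →₀ QField) :
    shL d a (Finsupp.single [] 1) f = f := by
  have : shL d a (Finsupp.single [] 1) = LinearMap.id := by
    apply linMap_ext
    intro w
    rw [shL_single, shWord_nil_left]; rfl
  rw [this]; rfl

theorem shL_one_right (d : Fin n → ℤ) (a : Fin n → Fin n → ℤ) (f : List (Fin n) →₀ QField) :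
    shL d a f (Finsupp.single [] 1) = f := by
  have : (shL d a).flip (Finsupp.single [] 1) = LinearMap.id := by
    apply linMap_ext
    intro w
    rw [LinearMap.flip_apply, shL_single, shWord_nil_right]; rfl
  rw [← LinearMap.flip_apply, this]; rfl

theorem dL_shWord (d : Fin n → ℤ) (a : Fin n → Fin n → ℤ) (y : Fin n) (u v : List (Fin n)) :
    dL y (shWord d a u v) = shL d a (dL y (Finsupp.single u 1)) (Finsupp.single v 1) +
      shL d a (kL d a y (Finsupp.single u 1)) (dL y (Finsupp.single v 1)) := by
  cases u with
  | nil =>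
    rw [shWord_nil_left, dL_single_nil, kL_single]
    simp [wt, shL_one_left]
  | cons x u =>
    cases v with
    | nil =>
      rw [shWord_nil_right, dL_single_nil, shL_one_right]
      simp
    | cons z v =>
      rw [shWord_cons_cons, map_add, map_smul, dL_consL, dL_consL, dL_single_cons,
        dL_single_cons, kL_single, map_smul, LinearMap.smul_apply]
      congr 1
      · split_ifs
        · rw [shL_single]
        · simp
      · by_cases h : z = y
        · subst h
          simp only [if_true]
          rw [shL_single]
        · simp [h]

theorem dL_shL (d : Fin n → ℤ) (a : Fin n → Fin n → ℤ) (y : Fin n)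
    (f g : List (Fin n) →₀ QField) :
    dL y (shL d a f g) = shL d a (dL y f) g + shL d a (kL d a y f) (dL y g) := by
  have : (shL d a).compr₂ (dL y) = (shL d a).comp (dL y) +
      (shL d a).compl₁₂ (kL d a y) (dL y) := by
    apply linMap_ext
    intro u
    apply linMap_ext
    intro v
    simp only [LinearMap.compr₂_apply, LinearMap.add_apply, LinearMap.comp_apply,
      LinearMap.compl₁₂_apply]
    rw [shL_single, dL_shWord]
  exact congrArg (fun F => F f g) this

theorem kL_shWord (d : Fin n → ℤ) (a : Fin n → Fin n → ℤ) (y : Fin n) (u v : List (Fin n)) :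
    kL d a y (shWord d a u v) = qvar ^ (-wt d a (u ++ v) y) • shWord d a u v := by
  unfold shWord
  rw [map_sum, Finset.smul_sum]
  refine Finset.sum_congr rfl fun σ _ => ?_
  rw [map_smul, kL_single, smul_comm]
  congr 3
  unfold wt
  rw [List.map_ofFn, List.sum_ofFn]
  conv_rhs => rw [← List.ofFn_get (u ++ v), List.map_ofFn, List.sum_ofFn]
  exact Equiv.sum_comp σ.symm (fun m => d ((u ++ v).get m) * a ((u ++ v).get m) y)

theorem kL_shL (d : Fin n → ℤ) (a : Fin n → Fin n → ℤ) (y : Fin n)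
    (f g : List (Fin n) →₀ QField) :
    kL d a y (shL d a f g) = shL d a (kL d a y f) (kL d a y g) := by
  have : (shL d a).compr₂ (kL d a y) = (shL d a).compl₁₂ (kL d a y) (kL d a y) := by
    apply linMap_ext
    intro u
    apply linMap_ext
    intro v
    simp only [LinearMap.compr₂_apply, LinearMap.compl₁₂_apply]
    rw [shL_single, kL_shWord, kL_single, kL_single]
    simp only [map_smul, LinearMap.smul_apply]
    rw [shL_single, smul_smul, ← zpow_add₀ qvar_ne_zero]
    congr 2
    simp [wt]
  exact congrArg (fun F => F f g) this

theorem shWord_apply_nil (d : Fin n → ℤ) (a : Fin n → Fin n → ℤ) (u v : List (Fin n)) :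
    shWord d a u v [] = (Finsupp.single u 1 : List (Fin n) →₀ QField) [] *
      (Finsupp.single v 1 : List (Fin n) →₀ QField) [] := by
  have hc : ∀ (x : Fin n) (f : List (Fin n) →₀ QField), consL x f [] = 0 := by
    intro x f
    have : (Finsupp.lapply []).comp (consL x) = 0 := by
      apply linMap_ext
      intro w
      rw [LinearMap.comp_apply, consL_single]
      simp
    exact congrArg (fun F => F f) this
  cases u with
  | nil => rw [shWord_nil_left]; simp
  | cons x u =>
    cases v with
    | nil => rw [shWord_nil_right]; simp
    | cons z v =>
      rw [shWord_cons_cons, Finsupp.add_apply, Finsupp.smul_apply, hc, hc]; simp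

theorem shL_apply_nil (d : Fin n → ℤ) (a : Fin n → Fin n → ℤ) (f g : List (Fin n) →₀ QField) :
    shL d a f g [] = f [] * g [] := by
  have : (shL d a).compr₂ (Finsupp.lapply []) =
      (LinearMap.mul QField QField).compl₁₂ (Finsupp.lapply []) (Finsupp.lapply []) := by
    apply linMap_ext
    intro u
    apply linMap_ext
    intro v
    simp only [LinearMap.compr₂_apply, LinearMap.compl₁₂_apply]
    rw [shL_single]
    exact shWord_apply_nil d a u v
  exact congrArg (fun F => F f g) this

/-! ### Quantum integers -/

theorem qvar_zpow_ne_one (m : ℤ) (hm : 0 < m) : qvar ^ m ≠ 1 := by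
  obtain ⟨k, rfl⟩ := Int.eq_ofNat_of_zero_le hm.le
  rw [zpow_natCast]
  intro h
  have h1 : algebraMap (Polynomial ℚ) (RatFunc ℚ) (Polynomial.X ^ k) =
      algebraMap (Polynomial ℚ) (RatFunc ℚ) 1 := by
    rw [map_pow, RatFunc.algebraMap_X, map_one]; exact h
  have h2 := RatFunc.algebraMap_injective ℚ h1
  have h3 := congrArg Polynomial.natDegree h2
  simp at h3
  subst h3
  simp at hm

/-- genericity of `z` -/
def Gen (z : QField) : Prop := z ≠ 0 ∧ ∀ m : ℤ, 0 < m → z ^ m ≠ 1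

theorem gen_qvar (e : ℤ) (he : 0 < e) : Gen (qvar ^ e) := by
  refine ⟨zpow_ne_zero _ qvar_ne_zero, fun m hm => ?_⟩
  rw [← zpow_mul]
  exact qvar_zpow_ne_one _ (mul_pos he hm)

theorem Gen.sub_ne {z : QField} (hz : Gen z) (m : ℤ) (hm : 0 < m) : z ^ m - z ^ (-m) ≠ 0 := by
  intro h
  apply hz.2 (m + m) (by omega)
  rw [sub_eq_zero] at h
  rw [zpow_add₀ hz.1]
  nth_rewrite 1 [h]
  rw [← zpow_add₀ hz.1]
  simp

theorem Gen.sub_inv_ne {z : QField} (hz : Gen z) : z - z⁻¹ ≠ 0 := by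
  simpa using hz.sub_ne 1 one_pos

theorem Gen.qInt_ne {z : QField} (hz : Gen z) (m : ℤ) (hm : 0 < m) : qInt z m ≠ 0 :=
  div_ne_zero (hz.sub_ne m hm) hz.sub_inv_ne

theorem Gen.qFact_ne {z : QField} (hz : Gen z) (m : ℕ) : qFact z m ≠ 0 := by
  induction m with
  | zero => exact one_ne_zero
  | succ m ih => exact mul_ne_zero (hz.qInt_ne _ (by omega)) ih

theorem Gen.qInt_add {z : QField} (hz : Gen z) (r s : ℤ) :
    qInt z (r + s) = z ^ r * qInt z s + z ^ (-s) * qInt z r := by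
  unfold qInt
  rw [mul_div_assoc', mul_div_assoc', ← add_div]
  congr 1
  rw [mul_sub, mul_sub]
  simp only [← zpow_add₀ hz.1]
  rw [neg_add, add_comm (-s) r, add_comm (-s) (-r)]
  ring_nf

theorem qBinom_zero {z : QField} (hz : Gen z) (m : ℕ) : qBinom z m 0 = 1 := by
  unfold qBinom
  have := hz.qFact_ne m
  simp [qFact, this]

theorem qBinom_self {z : QField} (hz : Gen z) (m : ℕ) : qBinom z m m = 1 := by
  unfold qBinom
  have := hz.qFact_ne m
  simp [qFact, this]

theorem qBinom_pascal {z : QField} (hz : Gen z) (k r : ℕ) :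
    qBinom z (k + 1 + r + 1) (k + 1) = z ^ ((k : ℤ) + 1) * qBinom z (k + 1 + r) (k + 1) +
      z ^ (-((r : ℤ) + 1)) * qBinom z (k + 1 + r) k := by
  unfold qBinom
  have e1 : k + 1 + r + 1 - (k + 1) = r + 1 := by omega
  have e2 : k + 1 + r - (k + 1) = r := by omega
  have e3 : k + 1 + r - k = r + 1 := by omega
  rw [e1, e2, e3]
  have h1 := hz.qFact_ne k
  have h2 := hz.qFact_ne r
  have h3 := hz.qInt_ne ((k : ℤ) + 1) (by omega)
  have h4 := hz.qInt_ne ((r : ℤ) + 1) (by omega)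
  have h5 : qFact z (k + 1 + r + 1) = (z ^ ((k : ℤ) + 1) * qInt z ((r : ℤ) + 1) +
      z ^ (-((r : ℤ) + 1)) * qInt z ((k : ℤ) + 1)) * qFact z (k + 1 + r) := by
    rw [← hz.qInt_add, qFact]
    congr 2
  rw [h5]
  simp only [qFact]
  generalize qFact z (k + 1 + r) = F
  generalize z ^ (-((r : ℤ) + 1)) = A
  generalize z ^ ((k : ℤ) + 1) = C
  field_simp

theorem qBinom_step {z : QField} (hz : Gen z) (k r : ℕ) :
    qBinom z (k + r + 1) (k + 1) * qInt z ((k : ℤ) + 1) =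
      qBinom z (k + r + 1) k * qInt z ((r : ℤ) + 1) := by
  unfold qBinom
  have e1 : k + r + 1 - (k + 1) = r := by omega
  have e3 : k + r + 1 - k = r + 1 := by omega
  rw [e1, e3]
  have h1 := hz.qFact_ne k
  have h2 := hz.qFact_ne r
  have h3 := hz.qInt_ne ((k : ℤ) + 1) (by omega)
  have h4 := hz.qInt_ne ((r : ℤ) + 1) (by omega)
  simp only [qFact]
  field_simp

theorem qBinom_partial {z : QField} (hz : Gen z) (M K : ℕ) (hK : K ≤ M) :
    ∑ k ∈ Finset.range (K + 1), (-1 : QField) ^ k * qBinom z (M + 1) k * z ^ ((M : ℤ) * k) =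
      (-1) ^ K * z ^ (((M : ℤ) + 1) * K) * qBinom z M K := by
  induction K with
  | zero => simp [qBinom_zero hz]
  | succ K ih =>
    obtain ⟨r, rfl⟩ := Nat.exists_eq_add_of_le hK
    rw [Finset.sum_range_succ, ih (by omega), qBinom_pascal hz]
    have e1 : z ^ ((K : ℤ) + 1) * z ^ (((K + 1 + r : ℕ) : ℤ) * ((K + 1 : ℕ) : ℤ)) =
        z ^ ((((K + 1 + r : ℕ) : ℤ) + 1) * ((K + 1 : ℕ) : ℤ)) := by
      rw [← zpow_add₀ hz.1]; congr 1; push_cast; ring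
    have e2 : z ^ (-((r : ℤ) + 1)) * z ^ (((K + 1 + r : ℕ) : ℤ) * ((K + 1 : ℕ) : ℤ)) =
        z ^ ((((K + 1 + r : ℕ) : ℤ) + 1) * (K : ℤ)) := by
      rw [← zpow_add₀ hz.1]; congr 1; push_cast; ring
    rw [← e1, ← e2, pow_succ]
    ring

theorem qBinom_alt {z : QField} (hz : Gen z) (M : ℕ) :
    ∑ k ∈ Finset.range (M + 1 + 1),
      (-1 : QField) ^ k * qBinom z (M + 1) k * z ^ ((M : ℤ) * k) = 0 := by
  rw [Finset.sum_range_succ, qBinom_partial hz M M le_rfl, qBinom_self hz, qBinom_self hz, pow_succ]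
  have : ((M : ℤ) + 1) * M = M * ((M + 1 : ℕ) : ℤ) := by push_cast; ring
  rw [this]
  ring

/-! ### Powers of a letter -/

/-- The one-sided quantum integer `z^{1-m}[m]_z`. -/
def cInt (z : QField) (m : ℕ) : QField := z ^ (1 - (m : ℤ)) * qInt z m

theorem cInt_zero (z : QField) : cInt z 0 = 0 := by simp [cInt, qInt]

theorem cInt_add {z : QField} (hz : Gen z) (k l : ℕ) :
    cInt z (k + l) = cInt z k + z ^ (-2 * (k : ℤ)) * cInt z l := by
  unfold cInt
  have e1 : z ^ (1 - (k : ℤ)) = z ^ (1 - ((l : ℤ) + k)) * z ^ (l : ℤ) := by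
    rw [← zpow_add₀ hz.1]; congr 1; ring
  have e2 : z ^ (-2 * (k : ℤ)) * z ^ (1 - (l : ℤ)) = z ^ (1 - ((l : ℤ) + k)) * z ^ (-(k : ℤ)) := by
    rw [← zpow_add₀ hz.1, ← zpow_add₀ hz.1]; congr 1; ring
  rw [add_comm k l]
  push_cast
  rw [hz.qInt_add, ← mul_assoc (z ^ (-2 * (k : ℤ))), e2, e1]
  ring

theorem cInt_one {z : QField} (hz : Gen z) : cInt z 1 = 1 := by
  have := hz.sub_inv_ne
  simp [cInt, qInt, this]

theorem shPow_succ (d : Fin n → ℤ) (a : Fin n → Fin n → ℤ) (x : List (Fin n) →₀ QField) (m : ℕ) :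
    shPow d a x (m + 1) = shL d a x (shPow d a x m) := by
  rw [← shMul_eq]; rfl

theorem kL_pow (d : Fin n → ℤ) (a : Fin n → Fin n → ℤ) (i y : Fin n) (k : ℕ) :
    kL d a y (shPow d a (Finsupp.single [i] 1) k) =
      qvar ^ (-(d i * a i y) * k) • shPow d a (Finsupp.single [i] 1) k := by
  induction k with
  | zero =>
    show kL d a y (Finsupp.single [] 1) = _ • Finsupp.single [] 1
    rw [kL_single]
    simp [wt]
  | succ k ih =>
    rw [shPow_succ, kL_shL, ih, kL_single, map_smul, map_smul, LinearMap.smul_apply, smul_smul,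
      ← zpow_add₀ qvar_ne_zero]
    congr 2
    simp [wt]
    ring

theorem dL_pow_ne (d : Fin n → ℤ) (a : Fin n → Fin n → ℤ) (i y : Fin n) (hy : i ≠ y) (k : ℕ) :
    dL y (shPow d a (Finsupp.single [i] 1) k) = 0 := by
  induction k with
  | zero => exact dL_single_nil y
  | succ k ih =>
    rw [shPow_succ, dL_shL, ih, dL_single_cons, if_neg hy]
    simp

theorem dL_pow (d : Fin n → ℤ) (hd : ∀ i, 0 < d i) (a : Fin n → Fin n → ℤ)
    (hdiag : ∀ i, a i i = 2) (i : Fin n) (k : ℕ) :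
    dL i (shPow d a (Finsupp.single [i] 1) k) =
      cInt (qvar ^ d i) k • shPow d a (Finsupp.single [i] 1) (k - 1) := by
  have hz := gen_qvar (d i) (hd i)
  induction k with
  | zero =>
    rw [cInt_zero, zero_smul]
    exact dL_single_nil i
  | succ k ih =>
    rw [shPow_succ, dL_shL, ih, dL_single_cons, if_pos rfl, shL_one_left, add_comm k 1,
      cInt_add hz, cInt_one hz, kL_single, map_smul, map_smul, LinearMap.smul_apply, add_smul,
      one_smul, smul_smul, Nat.add_sub_cancel_left]
    congr 1
    cases k with
    | zero => simp [cInt_zero]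
    | succ k =>
      rw [Nat.add_sub_cancel, ← shPow_succ]
      congr 1
      rw [mul_comm, ← zpow_mul]
      congr 2
      simp [wt, hdiag]

theorem pow_apply_nil (d : Fin n → ℤ) (a : Fin n → Fin n → ℤ) (i : Fin n) (k : ℕ) :
    shPow d a (Finsupp.single [i] 1) (k + 1) [] = 0 := by
  rw [shPow_succ, shL_apply_nil]
  simp

theorem pow_mul_pow (d : Fin n → ℤ) (hd : ∀ i, 0 < d i) (a : Fin n → Fin n → ℤ)
    (hdiag : ∀ i, a i i = 2) (i : Fin n) (N : ℕ) : ∀ k l, k + l = N →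
    shL d a (shPow d a (Finsupp.single [i] 1) k) (shPow d a (Finsupp.single [i] 1) l) =
      shPow d a (Finsupp.single [i] 1) N := by
  have hz := gen_qvar (d i) (hd i)
  induction N with
  | zero =>
    intro k l h
    obtain rfl : k = 0 := by omega
    obtain rfl : l = 0 := by omega
    exact shL_one_left d a _
  | succ N ih =>
    intro k l h
    rw [← sub_eq_zero]
    apply ext_dL
    · rw [Finsupp.sub_apply, pow_apply_nil, shL_apply_nil, sub_zero]
      cases k with
      | succ k => rw [pow_apply_nil, zero_mul]
      | zero =>
        obtain rfl : l = N + 1 := by omega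
        rw [pow_apply_nil, mul_zero]
    · intro y
      rw [map_sub, dL_shL]
      by_cases hy : i = y
      · subst hy
        rw [dL_pow d hd a hdiag, dL_pow d hd a hdiag, dL_pow d hd a hdiag, kL_pow]
        simp only [map_smul, LinearMap.smul_apply, Nat.add_sub_cancel]
        have h1 : cInt (qvar ^ d i) k • shL d a (shPow d a (Finsupp.single [i] 1) (k - 1))
            (shPow d a (Finsupp.single [i] 1) l) =
            cInt (qvar ^ d i) k • shPow d a (Finsupp.single [i] 1) N := by
          cases k with
          | zero => simp [cInt_zero]
          | succ k => rw [ih _ _ (by omega)]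
        have h2 : cInt (qvar ^ d i) l • shL d a (shPow d a (Finsupp.single [i] 1) k)
            (shPow d a (Finsupp.single [i] 1) (l - 1)) =
            cInt (qvar ^ d i) l • shPow d a (Finsupp.single [i] 1) N := by
          cases l with
          | zero => simp [cInt_zero]
          | succ l => rw [ih _ _ (by omega)]
        rw [h1, smul_comm (cInt (qvar ^ d i) l), h2, smul_smul, ← add_smul, ← h, cInt_add hz, ← sub_smul,
          ← zpow_mul]
        have : d i * (-2 * (k : ℤ)) = -(d i * a i i) * k := by rw [hdiag]; ring
        rw [this, sub_self, zero_smul]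
      · rw [dL_pow_ne d a i y hy, dL_pow_ne d a i y hy, dL_pow_ne d a i y hy]
        simp

theorem serre_aux (d : Fin n → ℤ) (hd : ∀ i, 0 < d i)
    (a : Fin n → Fin n → ℤ) (hdiag : ∀ i, a i i = 2)
    (hsymm : ∀ i j, d i * a i j = d j * a j i)
    (i j : Fin n) (hij : i ≠ j) (M : ℕ) (hM : a i j = -(M : ℤ)) :
    ∑ k ∈ Finset.range (M + 1 + 1),
      (((-1 : QField) ^ k * qBinom (qvar ^ (d i)) (M + 1) k) •
        shL d a
          (shL d a (shPow d a (Finsupp.single [i] 1) k) (Finsupp.single [j] 1))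
          (shPow d a (Finsupp.single [i] 1) (M + 1 - k))) = 0 := by
  have hz := gen_qvar (d i) (hd i)
  set z := qvar ^ (d i) with hzdef
  set X : ℕ → (List (Fin n) →₀ QField) := shPow d a (Finsupp.single [i] 1) with hX
  set P : ℕ → ℕ → (List (Fin n) →₀ QField) :=
    fun k l => shL d a (shL d a (X k) (Finsupp.single [j] 1)) (X l) with hP
  have hXi : ∀ k, dL i (X k) = cInt z k • X (k - 1) := dL_pow d hd a hdiag i
  have hPi : ∀ k l, dL i (P k l) = cInt z k • P (k - 1) l +
      (z ^ (-2 * (k : ℤ) + M) * cInt z l) • P k (l - 1) := by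
    intro k l
    simp only [hP]
    rw [dL_shL, dL_shL, hXi, hXi, dL_single_cons, if_neg (Ne.symm hij), map_zero, add_zero,
      kL_shL, kL_single, kL_pow]
    simp only [map_smul, LinearMap.smul_apply, smul_smul]
    congr 2
    rw [mul_comm (z ^ _)]
    rw [← zpow_add₀ qvar_ne_zero, hzdef, ← zpow_mul]
    congr 2
    have := hsymm i j
    simp only [wt, List.map_cons, List.map_nil, List.sum_cons, List.sum_nil]
    rw [← this, hM, hdiag]
    ring
  have hPj : ∀ k l, dL j (P k l) = z ^ ((M : ℤ) * k) • X (k + l) := by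
    intro k l
    simp only [hP]
    rw [dL_shL, dL_shL, dL_pow_ne d a i j hij, dL_pow_ne d a i j hij, dL_single_cons,
      if_pos rfl, kL_pow, shL_one_right, map_zero, LinearMap.zero_apply, zero_add, map_zero,
      add_zero, map_smul, LinearMap.smul_apply, pow_mul_pow d hd a hdiag i (k + l) k l rfl,
      hzdef, ← zpow_mul, hM]
    congr 2
    ring
  have hPo : ∀ y, i ≠ y → j ≠ y → ∀ k l, dL y (P k l) = 0 := by
    intro y hy hy' k l
    simp only [hP]
    rw [dL_shL, dL_shL, dL_pow_ne d a i y hy, dL_pow_ne d a i y hy, dL_single_cons,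
      if_neg hy']
    simp
  show ∑ k ∈ Finset.range (M + 1 + 1),
    ((-1 : QField) ^ k * qBinom z (M + 1) k) • P k (M + 1 - k) = 0
  apply ext_dL
  · rw [Finsupp.finsetSum_apply]
    refine Finset.sum_eq_zero fun k _ => ?_
    simp [hP, shL_apply_nil]
  intro y
  rw [map_sum]
  simp only [map_smul]
  by_cases hy : i = y
  · subst hy
    simp only [hPi, smul_add, smul_smul, Finset.sum_add_distrib]
    rw [Finset.sum_range_succ', Finset.sum_range_succ _ (M + 1)]
    simp only [cInt_zero, Nat.sub_self, mul_zero, zero_smul, add_zero]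
    rw [← Finset.sum_add_distrib]
    refine Finset.sum_eq_zero fun k hk => ?_
    have hk' : k ≤ M := by simpa [Nat.lt_succ_iff] using hk
    obtain ⟨r, rfl⟩ := Nat.exists_eq_add_of_le hk'
    have e1 : k + r + 1 - (k + 1) = r := by omega
    have e2 : k + r + 1 - k = r + 1 := by omega
    rw [e1, e2, Nat.add_sub_cancel, Nat.add_sub_cancel, ← add_smul]
    have hs := qBinom_step hz k r
    have e3 : z ^ (-2 * (k : ℤ) + ((k + r : ℕ) : ℤ)) * cInt z (r + 1) =
        z ^ (-(k : ℤ)) * qInt z ((r : ℤ) + 1) := by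
      unfold cInt
      rw [← mul_assoc, ← zpow_add₀ hz.1]
      push_cast
      congr 2
      ring
    have e4 : cInt z (k + 1) = z ^ (-(k : ℤ)) * qInt z ((k : ℤ) + 1) := by
      unfold cInt
      push_cast
      congr 2
      ring
    rw [e3, e4]
    have : (-1 : QField) ^ (k + 1) * qBinom z (k + r + 1) (k + 1) *
        (z ^ (-(k : ℤ)) * qInt z ((k : ℤ) + 1)) +
        (-1 : QField) ^ k * qBinom z (k + r + 1) k * (z ^ (-(k : ℤ)) * qInt z ((r : ℤ) + 1)) = 0 := by
      rw [pow_succ]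
      linear_combination (-(-1 : QField) ^ k * z ^ (-(k : ℤ))) * hs
    rw [this, zero_smul]
  by_cases hy' : j = y
  · subst hy'
    simp only [hPj, smul_smul]
    have : ∀ k ∈ Finset.range (M + 1 + 1),
        ((-1 : QField) ^ k * qBinom z (M + 1) k * z ^ ((M : ℤ) * k)) • X (k + (M + 1 - k)) =
        ((-1 : QField) ^ k * qBinom z (M + 1) k * z ^ ((M : ℤ) * k)) • X (M + 1) := by
      intro k hk
      have : k + (M + 1 - k) = M + 1 := by
        have := Finset.mem_range.1 hk
        omega
      rw [this]
    rw [Finset.sum_congr rfl this, ← Finset.sum_smul, qBinom_alt hz, zero_smul]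
  · simp only [hPo y hy hy', smul_zero, Finset.sum_const_zero]

/-- In the quantum shuffle algebra `Sh(V)` built on `V = ⊕ᵢ ℂvᵢ` with
braiding `vᵢ ⊗ vⱼ ↦ q^{-dᵢa_{ij}} vⱼ ⊗ vᵢ` (with `a_{ij} ≤ 0` for `i ≠ j` and
`dᵢ a_{ij} = dⱼ a_{ji}`), the elements `[vᵢ]` satisfy the quantum Serre relations
`Σ_{k=0}^{1-a_{ij}} (-1)^k binom_{q^{dᵢ}}(1-a_{ij}, k) [vᵢ]^{*k} * [vⱼ] * [vᵢ]^{*(1-a_{ij}-k)} = 0`. -/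
theorem stmt15 (d : Fin n → ℤ) (hd : ∀ i, 0 < d i)
    (a : Fin n → Fin n → ℤ)
    (hdiag : ∀ i, a i i = 2)
    (hoff : ∀ i j, i ≠ j → a i j ≤ 0)
    (hsymm : ∀ i j, d i * a i j = d j * a j i)
    (i j : Fin n) (hij : i ≠ j) :
    ∑ k ∈ Finset.range ((1 - a i j).toNat + 1),
      (((-1 : QField) ^ k * qBinom (qvar ^ (d i)) ((1 - a i j).toNat) k) •
        shMul d a
          (shMul d a (shPow d a (Finsupp.single [i] 1) k) (Finsupp.single [j] 1))
          (shPow d a (Finsupp.single [i] 1) ((1 - a i j).toNat - k))) = 0 := by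
  obtain ⟨M, hM⟩ := Int.eq_ofNat_of_zero_le (neg_nonneg.2 (hoff i j hij))
  have hM' : a i j = -(M : ℤ) := by omega
  have hN : (1 - a i j).toNat = M + 1 := by omega
  rw [hN]
  simp only [shMul_eq]
  exact serre_aux d hd a hdiag hsymm i j hij M hM'

end
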